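/- arXiv:1410.5749 — 2 statements merged into one kernel-verified Lean document; each statement's English description precedes it below -/
import Mathlib

section
/- Let r > 0, p ∈ ℝ³ with p ≠ 0, and N ∈ ℝ³. Define N̂ = N − (2⟪N,p⟫/‖p‖²) • p. Then ‖N̂‖ = ‖N‖, and for every v ∈ ℝ³ with ⟪N, v⟫ = 0 one has ⟪N̂, L_p v⟫ = 0, where L_p is the linear map v ↦ (r²/‖p‖²) • v − (2r²⟪p,v⟫/‖p‖⁴) • p. (Thus N̂ is a normal vector of unchanged length for the image of a surface with normal N under the inversion φ_r.) -/
open RealInnerProductSpace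

/-- For `p ≠ 0` and a normal vector `N`, the vector `N̂ = N − (2⟪N,p⟫/‖p‖²) • p` has the
same length as `N`, and it is orthogonal to the image under the differential
`L_p : v ↦ (r²/‖p‖²) • v − (2r²⟪p,v⟫/‖p‖⁴) • p` of the inversion `φ_r` of any vector `v`
orthogonal to `N`.  Thus `N̂` is a normal vector of unchanged length for the image of a
surface with normal `N` under the inversion `φ_r`. -/
theorem inverted_normal (r : ℝ) (hr : 0 < r) (p N : EuclideanSpace ℝ (Fin 3))
    (hp : p ≠ 0) :
    ‖N - (2 * ⟪N, p⟫ / ‖p‖ ^ 2) • p‖ = ‖N‖ ∧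
    ∀ v : EuclideanSpace ℝ (Fin 3), ⟪N, v⟫ = 0 →
      ⟪N - (2 * ⟪N, p⟫ / ‖p‖ ^ 2) • p,
        (r ^ 2 / ‖p‖ ^ 2) • v - (2 * r ^ 2 * ⟪p, v⟫ / ‖p‖ ^ 4) • p⟫ = 0 := by
  have hp' : ‖p‖ ≠ 0 := norm_ne_zero_iff.mpr hp
  refine ⟨?_, fun v hv => ?_⟩
  · rw [← sq_eq_sq₀ (norm_nonneg _) (norm_nonneg _), norm_sub_sq_real, real_inner_smul_right,
      norm_smul, mul_pow, Real.norm_eq_abs, sq_abs]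
    field_simp
    ring
  · simp only [inner_sub_left, inner_sub_right, real_inner_smul_left, real_inner_smul_right, hv,
      real_inner_self_eq_norm_sq]
    field_simp
    ring
end

section
/- Inversions transform lines of curvature and their principal curvatures as follows. Let r > 0 and let γ, N : ℝ → ℝ³ and λ : ℝ → ℝ be such that γ and N are differentiable, γ(t) ≠ 0 for all t, ⟪N(t), γ'(t)⟫ = 0 for all t, and N'(t) = −λ(t) • γ'(t) for all t. Define γ̂(t) = (r²/‖γ(t)‖²) • γ(t), N̂(t) = N(t) − (2⟪N(t), γ(t)⟫/‖γ(t)‖²) • γ(t), and λ̂(t) = (λ(t)‖γ(t)‖² + 2⟪N(t), γ(t)⟫)/r². Then N̂ is differentiable and N̂'(t) = −λ̂(t) • γ̂'(t) for all t. -/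
open RealInnerProductSpace

/-- Inversions transform lines of curvature and their principal curvatures: if `γ` is a line
of curvature of a surface with unit normal `N` along `γ` and principal curvature `λ`
(i.e. `⟪N, γ'⟫ = 0` and `N' = −λ • γ'`), with `γ(t) ≠ 0`, then the inverted curve
`γ̂ = (r²/‖γ‖²) • γ` with normal `N̂ = N − (2⟪N,γ⟫/‖γ‖²) • γ` satisfies
`N̂' = −λ̂ • γ̂'` where `λ̂ = (λ‖γ‖² + 2⟪N,γ⟫)/r²`. -/
theorem inversion_line_of_curvature (r : ℝ) (hr : 0 < r)
    (γ N : ℝ → EuclideanSpace ℝ (Fin 3)) (lam : ℝ → ℝ)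
    (hγ : Differentiable ℝ γ) (hN : Differentiable ℝ N)
    (hγ0 : ∀ t, γ t ≠ 0)
    (horth : ∀ t, ⟪N t, deriv γ t⟫ = 0)
    (hline : ∀ t, deriv N t = -lam t • deriv γ t) :
    Differentiable ℝ (fun t => N t - (2 * ⟪N t, γ t⟫ / ‖γ t‖ ^ 2) • γ t) ∧
    ∀ t, deriv (fun t => N t - (2 * ⟪N t, γ t⟫ / ‖γ t‖ ^ 2) • γ t) t =
      -((lam t * ‖γ t‖ ^ 2 + 2 * ⟪N t, γ t⟫) / r ^ 2) •
        deriv (fun t => (r ^ 2 / ‖γ t‖ ^ 2) • γ t) t := by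
  have hs0 : ∀ t, ‖γ t‖ ^ 2 ≠ 0 := fun t => pow_ne_zero 2 (norm_ne_zero_iff.mpr (hγ0 t))
  have hs : ∀ t, HasDerivAt (fun t => ‖γ t‖ ^ 2) (2 * ⟪γ t, deriv γ t⟫) t :=
    fun t => (hγ t).hasDerivAt.norm_sq
  have hn : ∀ t, HasDerivAt (fun t => 2 * ⟪N t, γ t⟫) (2 * (-lam t * ⟪γ t, deriv γ t⟫)) t := by
    intro t
    have h := ((hN t).hasDerivAt.inner ℝ (hγ t).hasDerivAt).const_mul 2
    rwa [horth, hline, real_inner_smul_left, zero_add, real_inner_comm] at h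
  have hNhat := fun t =>
    (hN t).hasDerivAt.fun_sub (((hn t).fun_div (hs t) (hs0 t)).fun_smul (hγ t).hasDerivAt)
  refine ⟨fun t => (hNhat t).differentiableAt, fun t => ?_⟩
  have hγhat :=
    ((hasDerivAt_const t (r ^ 2)).fun_div (hs t) (hs0 t)).fun_smul (hγ t).hasDerivAt
  rw [(hNhat t).deriv, hγhat.deriv, hline]
  have hγt := norm_ne_zero_iff.mpr (hγ0 t)
  have hr0 := hr.ne'
  match_scalars <;> field_simp <;> ring
end
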